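/- arXiv:1404.6655 — 2 statements merged into one kernel-verified Lean document; each statement's English description precedes it below -/
import Mathlib

section
/- Let ω > 0 and τ > 0, and define the delay cosine cos_τ(ω, ·) : ℝ → ℝ by cos_τ(ω, t) = 0 for t < −τ and, for each integer k ≥ 0 and t ∈ [(k−1)τ, kτ), cos_τ(ω, t) = Σ_{j=0}^{k} (−1)^j ω^{2j} (t − (j−1)τ)^{2j} / (2j)!. Then cos_τ(ω, ·) is continuously differentiable on (−τ, ∞), equals 1 on [−τ, 0), and satisfies x''(t) + ω² x(t − τ) = 0 for all t > 0. -/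
open Set MeasureTheory intervalIntegral Finset

/-- Away from the kink, the truncated power `x₊ ^ (n + 1)` has derivative `(n + 1) x₊ ^ n`. -/
theorem hasDerivAt_max_zero_pow_of_ne (n : ℕ) {x : ℝ} (hx : x ≠ 0) (hn : n ≠ 0 ∨ 0 < x) :
    HasDerivAt (fun y : ℝ => max y 0 ^ (n + 1)) ((n + 1) * max x 0 ^ n) x := by
  rcases lt_or_gt_of_ne hx with h | h
  · have hn : n ≠ 0 := hn.resolve_right h.not_gt
    rw [max_eq_right h.le, zero_pow hn, mul_zero]
    refine (hasDerivAt_const x (0 : ℝ)).congr_of_eventuallyEq ?_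
    filter_upwards [Iio_mem_nhds h] with y hy
    simp [max_eq_right (Set.mem_Iio.1 hy).le]
  · rw [max_eq_left h.le]
    have := hasDerivAt_pow (n + 1) x
    simp only [Nat.add_sub_cancel, Nat.cast_add, Nat.cast_one] at this
    refine this.congr_of_eventuallyEq ?_
    filter_upwards [Ioi_mem_nhds h] with y hy
    rw [max_eq_left (Set.mem_Ioi.1 hy).le]

theorem hasDerivAt_max_zero_pow {n : ℕ} {x : ℝ} (hn : n ≠ 0 ∨ 0 < x) :
    HasDerivAt (fun y : ℝ => max y 0 ^ (n + 1)) ((n + 1) * max x 0 ^ n) x := by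
  rcases hn with hn | hx
  · exact hasDerivAt_of_hasDerivAt_of_ne' (g := fun x : ℝ => ((n : ℝ) + 1) * max x 0 ^ n)
      (fun y hy => hasDerivAt_max_zero_pow_of_ne n hy (.inl hn))
      (by fun_prop) (by fun_prop) x
  · exact hasDerivAt_max_zero_pow_of_ne n hx.ne' (.inr hx)

/-- The delay cosine on `[-τ, Nτ)`, written as a single spline with truncated powers. -/
noncomputable def delayCosSpline (ω τ : ℝ) (N : ℕ) (t : ℝ) : ℝ :=
  1 + ∑ j ∈ Finset.range N, (-1 : ℝ) ^ (j + 1) * ω ^ (2 * (j + 1))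
    / (Nat.factorial (2 * (j + 1)) : ℝ) * max (t - j * τ) 0 ^ (2 * j + 1 + 1)

/-- The derivative of `delayCosSpline`. -/
noncomputable def delayCosSplineDeriv (ω τ : ℝ) (N : ℕ) (t : ℝ) : ℝ :=
  ∑ j ∈ Finset.range N, (-1 : ℝ) ^ (j + 1) * ω ^ (2 * (j + 1))
    / (Nat.factorial (2 * j + 1) : ℝ) * max (t - j * τ) 0 ^ (2 * j + 1)

theorem hasDerivAt_delayCosSpline (ω τ : ℝ) (N : ℕ) (t : ℝ) :
    HasDerivAt (delayCosSpline ω τ N) (delayCosSplineDeriv ω τ N t) t := by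
  unfold delayCosSpline delayCosSplineDeriv
  refine (HasDerivAt.fun_sum fun j _ => ?_).const_add 1
  have h := ((hasDerivAt_max_zero_pow (n := 2 * j + 1) (x := t - j * τ)
    (.inl (by lia))).comp_sub_const t (j * τ)).const_mul
    ((-1 : ℝ) ^ (j + 1) * ω ^ (2 * (j + 1)) / (Nat.factorial (2 * (j + 1)) : ℝ))
  refine h.congr_deriv ?_
  rw [show 2 * (j + 1) = (2 * j + 1) + 1 by ring, Nat.factorial_succ (2 * j + 1)]
  push_cast
  have : (Nat.factorial (2 * j + 1) : ℝ) ≠ 0 := by positivity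
  have : (2 * (j : ℝ) + 1 + 1) ≠ 0 := by positivity
  field_simp

theorem hasDerivAt_delayCosSplineDeriv (ω τ : ℝ) (N : ℕ) {t : ℝ} (ht : 0 < t) :
    HasDerivAt (delayCosSplineDeriv ω τ (N + 1)) (-ω ^ 2 * delayCosSpline ω τ N (t - τ)) t := by
  have h : HasDerivAt (delayCosSplineDeriv ω τ (N + 1))
      (∑ j ∈ Finset.range (N + 1), (-1 : ℝ) ^ (j + 1) * ω ^ (2 * (j + 1))
        / (Nat.factorial (2 * j) : ℝ) * max (t - j * τ) 0 ^ (2 * j)) t := by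
    unfold delayCosSplineDeriv
    refine HasDerivAt.fun_sum fun j _ => ?_
    have h := ((hasDerivAt_max_zero_pow (n := 2 * j) (x := t - j * τ)
      (by rcases j.eq_zero_or_pos with rfl | hj
          · right; simpa using ht
          · left; lia)).comp_sub_const t (j * τ)).const_mul
      ((-1 : ℝ) ^ (j + 1) * ω ^ (2 * (j + 1)) / (Nat.factorial (2 * j + 1) : ℝ))
    refine h.congr_deriv ?_
    rw [Nat.factorial_succ (2 * j)]
    push_cast
    have : (Nat.factorial (2 * j) : ℝ) ≠ 0 := by positivity
    have : (2 * (j : ℝ) + 1) ≠ 0 := by positivity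
    field_simp
  refine h.congr_deriv ?_
  rw [Finset.sum_range_succ', delayCosSpline, mul_add (-ω ^ 2), Finset.mul_sum, add_comm]
  congr 1
  · simp
  · refine Finset.sum_congr rfl fun j _ => ?_
    rw [show t - ((j + 1 : ℕ) : ℝ) * τ = t - τ - j * τ by push_cast; ring]
    ring

theorem continuous_delayCosSplineDeriv (ω τ : ℝ) (N : ℕ) :
    Continuous (delayCosSplineDeriv ω τ N) := by
  unfold delayCosSplineDeriv
  fun_prop

theorem sum_eq_delayCosSpline {ω τ : ℝ} (hτ : 0 < τ) {k N : ℕ} (hkN : k ≤ N) {t : ℝ}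
    (ht : t ∈ Ico (((k : ℝ) - 1) * τ) ((k : ℝ) * τ)) :
    ∑ j ∈ Finset.range (k + 1),
        (-1 : ℝ) ^ j * ω ^ (2 * j) * (t - ((j : ℝ) - 1) * τ) ^ (2 * j)
          / (Nat.factorial (2 * j) : ℝ) = delayCosSpline ω τ N t := by
  rw [Finset.sum_range_succ', delayCosSpline, add_comm]
  congr 1
  · simp
  rw [← Finset.sum_subset (Finset.range_mono hkN)]
  · refine Finset.sum_congr rfl fun j hj => ?_
    have hjk : (j : ℝ) + 1 ≤ k := by exact_mod_cast Finset.mem_range.1 hj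
    have : (j : ℝ) * τ ≤ (k - 1) * τ := by gcongr; linarith
    rw [max_eq_left (by linarith [ht.1])]
    push_cast
    ring
  · intro j _ hj
    have hkj : (k : ℝ) ≤ j := by exact_mod_cast not_lt.1 (mt Finset.mem_range.2 hj)
    have : (k : ℝ) * τ ≤ j * τ := by gcongr
    rw [max_eq_right (by linarith [ht.2])]
    simp

theorem exists_mem_Ico_nat_mul {τ : ℝ} (hτ : 0 < τ) {N : ℕ} {t : ℝ}
    (ht : t ∈ Ico (-τ) (N * τ)) :
    ∃ k ≤ N, t ∈ Ico (((k : ℝ) - 1) * τ) ((k : ℝ) * τ) := by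
  have h0 : 0 ≤ t / τ + 1 := by
    have : -1 ≤ t / τ := by rw [le_div_iff₀ hτ]; linarith [ht.1]
    linarith
  have h1 := Nat.floor_le h0
  have h2 := Nat.lt_floor_add_one (t / τ + 1)
  have hN : t / τ < N := by rw [div_lt_iff₀ hτ]; exact ht.2
  refine ⟨⌊t / τ + 1⌋₊, ?_, ?_, ?_⟩
  · rw [← Nat.lt_add_one_iff, Nat.floor_lt h0]
    push_cast
    linarith
  · rw [← le_div_iff₀ hτ]; linarith
  · rw [← div_lt_iff₀ hτ]; linarith

/-- The delay cosine `cos_τ(ω, ·)` — vanishing below `−τ` and given on each step interval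
`[(k−1)τ, kτ)` by the alternating polynomial sum — is continuously differentiable on
`(−τ, ∞)`, equals `1` on `[−τ, 0)`, and solves the pure-delay oscillation equation
`x''(t) + ω² x(t − τ) = 0` for `t > 0`. -/
theorem delay_cosine_properties
    (ω τ : ℝ) (hω : 0 < ω) (hτ : 0 < τ)
    (C : ℝ → ℝ)
    (hCpast : ∀ t < -τ, C t = 0)
    (hCstep : ∀ k : ℕ, ∀ t ∈ Ico (((k : ℝ) - 1) * τ) ((k : ℝ) * τ),
      C t = ∑ j ∈ Finset.range (k + 1),
        (-1 : ℝ) ^ j * ω ^ (2 * j) * (t - ((j : ℝ) - 1) * τ) ^ (2 * j)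
          / (Nat.factorial (2 * j) : ℝ)) :
    ContDiffOn ℝ 1 C (Ioi (-τ)) ∧
    (∀ t ∈ Ico (-τ) (0 : ℝ), C t = 1) ∧
    (∀ t > 0, deriv (deriv C) t + ω ^ 2 * C (t - τ) = 0) := by
  have hC (N : ℕ) : ∀ t ∈ Ico (-τ) (N * τ), C t = delayCosSpline ω τ N t := by
    intro t ht
    obtain ⟨k, hkN, hk⟩ := exists_mem_Ico_nat_mul hτ ht
    rw [hCstep k t hk, sum_eq_delayCosSpline hτ hkN hk]
  have hlt (t : ℝ) : ∃ M : ℕ, t < (M + 1 : ℕ) * τ := by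
    obtain ⟨M, hM⟩ := exists_nat_gt (t / τ)
    refine ⟨M, (div_lt_iff₀ hτ).1 (hM.trans ?_)⟩
    push_cast
    linarith
  have hC' (N : ℕ) : ∀ t ∈ Ioo (-τ) (N * τ), HasDerivAt C (delayCosSplineDeriv ω τ N t) t := by
    intro t ht
    refine (hasDerivAt_delayCosSpline ω τ N t).congr_of_eventuallyEq ?_
    filter_upwards [Ioo_mem_nhds ht.1 ht.2] with s hs using hC N s (Ioo_subset_Ico_self hs)
  have hderiv (N : ℕ) {t : ℝ} (ht : t ∈ Ioo (-τ) (N * τ)) :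
      deriv C =ᶠ[nhds t] delayCosSplineDeriv ω τ N := by
    filter_upwards [Ioo_mem_nhds ht.1 ht.2] with s hs using (hC' N s hs).deriv
  refine ⟨?_, fun t ht => ?_, fun t ht => ?_⟩
  · rw [show (1 : WithTop ℕ∞) = 0 + 1 by simp, contDiffOn_succ_iff_deriv_of_isOpen isOpen_Ioi]
    refine ⟨fun t ht => ?_, by simp, contDiffOn_zero.2 fun t ht => ?_⟩ <;>
      obtain ⟨M, hM⟩ := hlt t
    · exact (hC' _ t ⟨ht, hM⟩).differentiableAt.differentiableWithinAt
    · exact ((continuous_delayCosSplineDeriv ω τ _).continuousAt.congr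
        (hderiv _ ⟨ht, hM⟩).symm).continuousWithinAt
  · simpa [delayCosSpline] using hC 0 t (by simpa using ht)
  · obtain ⟨M, hM⟩ := hlt t
    rw [(hderiv (M + 1) ⟨by linarith, hM⟩).deriv_eq,
      (hasDerivAt_delayCosSplineDeriv ω τ M ht).deriv,
      hC M (t - τ) ⟨by linarith, by push_cast at hM; linarith⟩]
    ring
end

section
/- Let ω > 0 and τ > 0. With the delay cosine cos_τ(ω, t) = Σ_{j=0}^{k} (−1)^j ω^{2j} (t − (j−1)τ)^{2j} / (2j)! and delay sine sin_τ(ω, t) = Σ_{j=0}^{k} (−1)^j ω^{2j+1} (t − (j−1)τ)^{2j+1} / (2j+1)! for t ∈ [(k−1)τ, kτ), k ≥ 0 (both vanishing for t < −τ), the derivative of the delay sine equals ω times the delay cosine: for every t > −τ that is not of the form kτ with k a nonnegative integer, d/dt sin_τ(ω, t) = ω · cos_τ(ω, t). -/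
open Set MeasureTheory intervalIntegral Finset

/-- A term of the delay sine series differentiates to `ω` times the corresponding term of the
delay cosine series. -/
lemma hasDerivAt_delay_sine_term (ω a t : ℝ) (j : ℕ) :
    HasDerivAt
      (fun s : ℝ ↦ (-1 : ℝ) ^ j * ω ^ (2 * j + 1) * (s - a) ^ (2 * j + 1)
        / (Nat.factorial (2 * j + 1) : ℝ))
      (ω * ((-1 : ℝ) ^ j * ω ^ (2 * j) * (t - a) ^ (2 * j)
        / (Nat.factorial (2 * j) : ℝ))) t := by
  have h := ((((hasDerivAt_id t).sub_const a).pow (2 * j + 1)).const_mul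
    ((-1 : ℝ) ^ j * ω ^ (2 * j + 1))).div_const (Nat.factorial (2 * j + 1) : ℝ)
  refine h.congr_deriv ?_
  have hne : (Nat.factorial (2 * j) : ℝ) ≠ 0 := by positivity
  have hne' : (2 * (j : ℝ) + 1) ≠ 0 := by positivity
  simp only [Nat.factorial_succ, id, Nat.add_sub_cancel]
  push_cast
  field_simp
  ring

/-- Every `t > -τ` lies in one of the intervals `[(k - 1)τ, kτ)`. -/
lemma exists_nat_mem_Ico_sub_one_mul {τ t : ℝ} (hτ : 0 < τ) (ht : -τ < t) :
    ∃ k : ℕ, ((k : ℝ) - 1) * τ ≤ t ∧ t < (k : ℝ) * τ := by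
  have hpos : 0 ≤ t / τ + 1 := by
    have : -1 < t / τ := by rw [lt_div_iff₀ hτ]; linarith
    linarith
  refine ⟨⌊t / τ + 1⌋₊, ?_, ?_⟩
  · rw [← le_div_iff₀ hτ]
    linarith [Nat.floor_le hpos]
  · rw [← div_lt_iff₀ hτ]
    linarith [Nat.lt_floor_add_one (t / τ + 1)]

/-- The derivative of the delay sine equals `ω` times the delay cosine at every point
`t > −τ` that is not of the form `kτ` with `k` a nonnegative integer. -/
theorem deriv_delay_sine_eq_omega_mul_delay_cosine
    (ω τ : ℝ) (hω : 0 < ω) (hτ : 0 < τ)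
    (C S : ℝ → ℝ)
    (hCpast : ∀ t < -τ, C t = 0)
    (hSpast : ∀ t < -τ, S t = 0)
    (hCstep : ∀ k : ℕ, ∀ t ∈ Ico (((k : ℝ) - 1) * τ) ((k : ℝ) * τ),
      C t = ∑ j ∈ Finset.range (k + 1),
        (-1 : ℝ) ^ j * ω ^ (2 * j) * (t - ((j : ℝ) - 1) * τ) ^ (2 * j)
          / (Nat.factorial (2 * j) : ℝ))
    (hSstep : ∀ k : ℕ, ∀ t ∈ Ico (((k : ℝ) - 1) * τ) ((k : ℝ) * τ),
      S t = ∑ j ∈ Finset.range (k + 1),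
        (-1 : ℝ) ^ j * ω ^ (2 * j + 1) * (t - ((j : ℝ) - 1) * τ) ^ (2 * j + 1)
          / (Nat.factorial (2 * j + 1) : ℝ)) :
    ∀ t > -τ, (∀ k : ℕ, t ≠ (k : ℝ) * τ) → deriv S t = ω * C t := by
  intro t ht hne
  obtain ⟨k, hk₁, hk₂⟩ := exists_nat_mem_Ico_sub_one_mul hτ ht
  have hlt : ((k : ℝ) - 1) * τ < t := by
    refine lt_of_le_of_ne hk₁ ?_
    rintro rfl
    cases k with
    | zero => norm_num at ht
    | succ m => exact hne m (by push_cast; ring)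
  rw [hCstep k t ⟨hk₁, hk₂⟩, Finset.mul_sum]
  refine HasDerivAt.deriv (HasDerivAt.congr_of_eventuallyEq
    (HasDerivAt.fun_sum fun j _ ↦ hasDerivAt_delay_sine_term ω (((j : ℝ) - 1) * τ) t j) ?_)
  filter_upwards [Ioo_mem_nhds hlt hk₂] with s hs
  exact hSstep k s ⟨hs.1.le, hs.2⟩
end
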